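/- Let A be the Cartan matrix of type E₇ (indices ordered α, β, γ, δ, ε, η, σ, with chain α–β–γ–δ–ε–η and σ attached to δ), let R = { n ∈ ℤ⁷ : nᵀAn = 2 }, and let s_j(n) = n − (Σᵢ nᵢ A_{ij})·e_j be the simple reflections. Set w₁ = s_ε ∘ s_β ∘ s_γ ∘ s_α ∘ s_β and w₂ = s_ε ∘ s_β ∘ s_γ ∘ s_α ∘ s_β ∘ s_η ∘ s_δ ∘ s_β, and let K = ⟨w₁, w₂⟩. Then K preserves the 42-element set Ψ = { n ∈ R : n_σ ≥ 1 }, and the action of K on Ψ has exactly five orbits, of cardinalities 7, 7, 14, 7, and 7; moreover the orbits of cardinality 7 other than { n ∈ Ψ : n_σ = 2 } all consist of vectors with n_σ = 1, and { n ∈ Ψ : n_σ = 2 } is itself a single K-orbit. -/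

import Mathlib

/-- The Cartan matrix of type E₇, rows and columns indexed by the simple roots
α, β, γ, δ, ε, η, σ in that order (indices 0,…,6), where α–β–γ–δ–ε–η form a chain and σ is
attached to δ in the Dynkin diagram. -/
def cartanE7 : Matrix (Fin 7) (Fin 7) ℤ :=
  !![2, -1, 0, 0, 0, 0, 0;
     -1, 2, -1, 0, 0, 0, 0;
     0, -1, 2, -1, 0, 0, 0;
     0, 0, -1, 2, -1, 0, -1;
     0, 0, 0, -1, 2, -1, 0;
     0, 0, 0, 0, -1, 2, 0;
     0, 0, 0, -1, 0, 0, 2]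

/-- The linear functional n ↦ Σᵢ nᵢ A_{ij} on ℤ⁷. -/
def coeff (j : Fin 7) : (Fin 7 → ℤ) →ₗ[ℤ] ℤ :=
  ∑ i : Fin 7, cartanE7 i j • LinearMap.proj i

/-- The simple reflection s_j : ℤ⁷ → ℤ⁷, s_j(n) = n − (Σᵢ nᵢ A_{ij})·e_j, as a linear map. -/
def reflMap (j : Fin 7) : (Fin 7 → ℤ) →ₗ[ℤ] (Fin 7 → ℤ) :=
  LinearMap.id - LinearMap.smulRight (coeff j) (Pi.single j 1)

theorem reflMap_apply (j : Fin 7) (m : Fin 7 → ℤ) :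
    reflMap j m = m - (∑ i : Fin 7, cartanE7 i j * m i) • Pi.single j 1 := by
  simp only [reflMap, coeff, LinearMap.sub_apply, LinearMap.id_apply,
    LinearMap.smulRight_apply, LinearMap.sum_apply, Finset.sum_apply, LinearMap.smul_apply,
    LinearMap.proj_apply, smul_eq_mul]

theorem reflMap_involutive (j : Fin 7) : Function.Involutive (reflMap j) := by
  intro n
  have hAjj : (∑ i : Fin 7, cartanE7 i j * (Pi.single j 1 : Fin 7 → ℤ) i) = 2 := by
    fin_cases j <;> simp [cartanE7, Fin.sum_univ_seven, Pi.single_apply] <;> decide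
  rw [reflMap_apply, reflMap_apply]
  set c : ℤ := ∑ i : Fin 7, cartanE7 i j * n i with hc
  have hsum : (∑ i : Fin 7, cartanE7 i j * (n - c • Pi.single j 1 : Fin 7 → ℤ) i) = -c := by
    simp only [Pi.sub_apply, Pi.smul_apply, smul_eq_mul, mul_sub, Finset.sum_sub_distrib]
    rw [show (∑ i : Fin 7, cartanE7 i j * (c * (Pi.single j 1 : Fin 7 → ℤ) i)) =
        c * ∑ i : Fin 7, cartanE7 i j * (Pi.single j 1 : Fin 7 → ℤ) i by
      rw [Finset.mul_sum]; exact Finset.sum_congr rfl fun i _ => by ring]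
    rw [hAjj, ← hc]
    ring
  rw [hsum]
  clear_value c
  module

/-- The simple reflection s_j as a linear automorphism of ℤ⁷. -/
def simpleReflection (j : Fin 7) : (Fin 7 → ℤ) ≃ₗ[ℤ] (Fin 7 → ℤ) :=
  LinearEquiv.ofInvolutive (reflMap j) (reflMap_involutive j)

/-- w₁ = s_ε ∘ s_β ∘ s_γ ∘ s_α ∘ s_β (indices α=0, β=1, γ=2, δ=3, ε=4, η=5, σ=6);
multiplication in the automorphism group is composition, so s_β is applied first. -/
def w1 : (Fin 7 → ℤ) ≃ₗ[ℤ] (Fin 7 → ℤ) :=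
  simpleReflection 4 * simpleReflection 1 * simpleReflection 2 * simpleReflection 0 *
    simpleReflection 1

/-- w₂ = s_ε ∘ s_β ∘ s_γ ∘ s_α ∘ s_β ∘ s_η ∘ s_δ ∘ s_β. -/
def w2 : (Fin 7 → ℤ) ≃ₗ[ℤ] (Fin 7 → ℤ) :=
  simpleReflection 4 * simpleReflection 1 * simpleReflection 2 * simpleReflection 0 *
    simpleReflection 1 * simpleReflection 5 * simpleReflection 3 * simpleReflection 1

open Matrix in
/-- The set of roots of E₇ in simple-root coordinates: the integer vectors n with nᵀAn = 2. -/
def rootsE7 : Set (Fin 7 → ℤ) :=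
  {n | n ⬝ᵥ cartanE7.mulVec n = 2}

/-- The subgroup K = ⟨w₁, w₂⟩ of the group of linear automorphisms of ℤ⁷. -/
def KE7 : Subgroup ((Fin 7 → ℤ) ≃ₗ[ℤ] (Fin 7 → ℤ)) :=
  Subgroup.closure {w1, w2}

/-- The 42-element set Ψ = {n ∈ R : n_σ ≥ 1} of roots of positive σ-weight (σ is index 6). -/
def PsiE7 : Set (Fin 7 → ℤ) :=
  {n ∈ rootsE7 | 1 ≤ n 6}

/-- Explicit coordinate formula for `w1`. -/
def f1 (n : Fin 7 → ℤ) : Fin 7 → ℤ :=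
  ![-n 1 + n 2, -n 1 + n 3, n 0 - n 1 + n 3, n 3, n 3 - n 4 + n 5, n 5, n 6]

/-- Explicit coordinate formula for `w2`. -/
def f2 (n : Fin 7 → ℤ) : Fin 7 → ℤ :=
  ![-n 0 + n 1, -n 0 + n 1 - n 3 + n 4 + n 6, n 1 - n 3 + n 4 + n 6, n 2 - n 3 + n 4 + n 6,
    n 2 - n 3 + n 4 - n 5 + n 6, n 4 - n 5, n 6]

theorem simpleReflection_apply (j : Fin 7) (m : Fin 7 → ℤ) :
    simpleReflection j m = m - (∑ i : Fin 7, cartanE7 i j * m i) • Pi.single j 1 :=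
  reflMap_apply j m

theorem simpleReflection_eq (j : Fin 7) (m : Fin 7 → ℤ) :
    simpleReflection j m = Function.update m j (m j - ∑ i : Fin 7, cartanE7 i j * m i) := by
  rw [simpleReflection_apply]
  funext i
  by_cases h : i = j
  · subst h; simp
  · simp [h]

theorem refl_formula (a b c d e f g : ℤ) :
    simpleReflection 0 ![a, b, c, d, e, f, g] = ![-a + b, b, c, d, e, f, g] ∧
    simpleReflection 1 ![a, b, c, d, e, f, g] = ![a, a - b + c, c, d, e, f, g] ∧
    simpleReflection 2 ![a, b, c, d, e, f, g] = ![a, b, b - c + d, d, e, f, g] ∧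
    simpleReflection 3 ![a, b, c, d, e, f, g] = ![a, b, c, c - d + e + g, e, f, g] ∧
    simpleReflection 4 ![a, b, c, d, e, f, g] = ![a, b, c, d, d - e + f, f, g] ∧
    simpleReflection 5 ![a, b, c, d, e, f, g] = ![a, b, c, d, e, e - f, g] := by
  refine ⟨?_, ?_, ?_, ?_, ?_, ?_⟩ <;>
  · rw [simpleReflection_eq]
    funext i
    fin_cases i <;> simp [cartanE7, Fin.sum_univ_seven, Function.update] <;> ring

theorem vec_eta (n : Fin 7 → ℤ) : n = ![n 0, n 1, n 2, n 3, n 4, n 5, n 6] := by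
  funext i; fin_cases i <;> rfl

theorem exists_vec (n : Fin 7 → ℤ) : ∃ a b c d e f g : ℤ, n = ![a, b, c, d, e, f, g] :=
  ⟨_, _, _, _, _, _, _, vec_eta n⟩

theorem w1_apply (n : Fin 7 → ℤ) : w1 n = f1 n := by
  obtain ⟨a, b, c, d, e, f, g, rfl⟩ := exists_vec n
  simp only [w1, LinearEquiv.mul_apply, refl_formula]
  funext i
  fin_cases i <;> simp [f1] <;> ring

theorem w2_apply (n : Fin 7 → ℤ) : w2 n = f2 n := by
  obtain ⟨a, b, c, d, e, f, g, rfl⟩ := exists_vec n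
  simp only [w2, LinearEquiv.mul_apply, refl_formula]
  funext i
  fin_cases i <;> simp [f2] <;> ring

/-- The candidate orbit of `a`. -/
def orb (a : Fin 7 → ℤ) : Finset (Fin 7 → ℤ) :=
  (Finset.range 7 ×ˢ Finset.range 2).image fun p => f2^[p.1] (f1^[p.2] a)

theorem iter1 (k : ℕ) (n : Fin 7 → ℤ) : (w1 ^ k) n = f1^[k] n := by
  induction k generalizing n with
  | zero => rfl
  | succ k ih => rw [pow_succ, LinearEquiv.mul_apply, ih, w1_apply]; rfl

theorem iter2 (k : ℕ) (n : Fin 7 → ℤ) : (w2 ^ k) n = f2^[k] n := by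
  induction k generalizing n with
  | zero => rfl
  | succ k ih => rw [pow_succ, LinearEquiv.mul_apply, ih, w2_apply]; rfl

theorem maps_of_closed (F : Finset (Fin 7 → ℤ))
    (h : ∀ x ∈ F, f1 x ∈ F ∧ f2 x ∈ F) : ∀ g ∈ KE7, ∀ x ∈ F, g x ∈ F := by
  intro g hg
  induction hg using Subgroup.closure_induction with
  | mem g hg =>
    rcases hg with rfl | rfl
    · intro x hx; rw [w1_apply]; exact (h x hx).1
    · intro x hx; rw [w2_apply]; exact (h x hx).2
  | one => intro x hx; exact hx
  | mul a b _ _ iha ihb => intro x hx; exact iha _ (ihb _ hx)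
  | inv a _ ih =>
    intro x hx
    have him : F.image a = F := by
      apply Finset.eq_of_subset_of_card_le
      · intro y hy
        obtain ⟨z, hz, rfl⟩ := Finset.mem_image.1 hy
        exact ih z hz
      · rw [Finset.card_image_of_injective _ a.injective]
    rw [← him] at hx
    obtain ⟨z, hz, rfl⟩ := Finset.mem_image.1 hx
    have : a⁻¹ (a z) = z := a.symm_apply_apply z
    rwa [this]

theorem orbit_eq (a : Fin 7 → ℤ) (h : ∀ x ∈ orb a, f1 x ∈ orb a ∧ f2 x ∈ orb a) :
    MulAction.orbit KE7 a = (orb a : Set (Fin 7 → ℤ)) := by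
  ext x
  constructor
  · rintro ⟨⟨g, hg⟩, rfl⟩
    refine maps_of_closed _ h g hg a ?_
    exact Finset.mem_image.2 ⟨(0, 0), by simp, rfl⟩
  · intro hx
    obtain ⟨⟨k, e⟩, _, rfl⟩ := Finset.mem_image.1 (Finset.mem_coe.1 hx)
    have h1 : w1 ∈ KE7 := Subgroup.subset_closure (by simp)
    have h2 : w2 ∈ KE7 := Subgroup.subset_closure (by simp)
    refine ⟨⟨w2 ^ k * w1 ^ e, KE7.mul_mem (KE7.pow_mem h2 k) (KE7.pow_mem h1 e)⟩, ?_⟩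
    change (w2 ^ k * w1 ^ e) a = _
    rw [LinearEquiv.mul_apply, iter1, iter2]

/-- Orbit representatives. -/
def rep : Fin 5 → Fin 7 → ℤ :=
  ![![0, 0, 0, 0, 0, 0, 1], ![0, 0, 1, 1, 1, 0, 1], ![0, 0, 0, 1, 1, 0, 1],
    ![0, 0, 1, 1, 1, 1, 1], ![0, 1, 2, 3, 2, 1, 2]]

theorem rep_closed : ∀ i, ∀ x ∈ orb (rep i), f1 x ∈ orb (rep i) ∧ f2 x ∈ orb (rep i) := by
  decide +kernel

theorem rep_card : ∀ i, (orb (rep i)).card = ![7, 7, 14, 7, 7] i := by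
  decide +kernel

theorem rep_disj : ∀ i j, i ≠ j → rep i ∉ orb (rep j) := by
  decide +kernel

/-- The union of the five orbits. -/
def allPsi : Finset (Fin 7 → ℤ) := Finset.univ.biUnion fun i => orb (rep i)

theorem allPsi_card : allPsi.card = 42 := by
  decide +kernel

/-- The quadratic form on roots. -/
def quad (n : Fin 7 → ℤ) : ℤ :=
  n 0 ^ 2 + (n 1 - n 0) ^ 2 + (n 2 - n 1) ^ 2 + (n 3 - n 2) ^ 2 + (n 4 - n 3 + n 6) ^ 2
    + (n 5 - n 4 + n 6) ^ 2 + (n 6 - n 5) ^ 2 - n 6 ^ 2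

theorem mem_Psi (n : Fin 7 → ℤ) : n ∈ PsiE7 ↔ quad n = 2 ∧ 1 ≤ n 6 := by
  have : n ⬝ᵥ cartanE7.mulVec n = quad n := by
    simp [dotProduct, Matrix.mulVec, cartanE7, Fin.sum_univ_seven, quad]
    ring
  simp only [PsiE7, rootsE7, Set.mem_setOf_eq, this]

theorem allPsi_sub : ∀ n ∈ allPsi, quad n = 2 ∧ 1 ≤ n 6 := by
  decide +kernel

theorem bits : ∀ k : Fin 2, ∀ a b c d e f g : Fin 2,
    (a : ℕ) + b + c + d + e + f + g = 3 * (k + 1) →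
    (![a, a + b, a + b + c, a + b + c + d, a + b + c + d + e - (k + 1),
      a + b + c + d + e + f - 2 * (k + 1), k + 1] : Fin 7 → ℤ) ∈ allPsi := by
  decide +kernel

theorem bit_lift (x : ℤ) (h : x * (x - 1) = 0) : ∃ b : Fin 2, x = (b : ℕ) := by
  rcases mul_eq_zero.1 h with h | h
  · exact ⟨0, by simpa using h⟩
  · exact ⟨1, by simp; omega⟩

theorem mul_pred_nonneg (x : ℤ) : 0 ≤ x * (x - 1) := by
  rcases le_or_gt x 0 with h | h
  · nlinarith
  · exact mul_nonneg (by omega) (by omega)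

theorem Psi_sub (n : Fin 7 → ℤ) (hq : quad n = 2) (h6 : 1 ≤ n 6) : n ∈ allPsi := by
  unfold quad at hq
  obtain ⟨a, ha⟩ : ∃ a, a = n 0 := ⟨_, rfl⟩
  obtain ⟨b, hb⟩ : ∃ b, b = n 1 - n 0 := ⟨_, rfl⟩
  obtain ⟨c, hc⟩ : ∃ c, c = n 2 - n 1 := ⟨_, rfl⟩
  obtain ⟨d, hd⟩ : ∃ d, d = n 3 - n 2 := ⟨_, rfl⟩
  obtain ⟨e, he⟩ : ∃ e, e = n 4 - n 3 + n 6 := ⟨_, rfl⟩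
  obtain ⟨f, hf⟩ : ∃ f, f = n 5 - n 4 + n 6 := ⟨_, rfl⟩
  obtain ⟨g, hg⟩ : ∃ g, g = n 6 - n 5 := ⟨_, rfl⟩
  obtain ⟨k, hk⟩ : ∃ k, k = n 6 := ⟨_, rfl⟩
  rw [← hb, ← hc, ← hd, ← he, ← hf, ← hg, ← ha, ← hk] at hq
  rw [← hk] at h6
  have hs : a + b + c + d + e + f + g = 3 * k := by omega
  have hk2 : k ≤ 2 := by
    by_contra hcon
    have h3 : 3 ≤ k := by omega
    -- 7 Σ m² ≥ (Σ m)², from Σ (7 m - 3 k)² ≥ 0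
    nlinarith [sq_nonneg (7 * a - 3 * k), sq_nonneg (7 * b - 3 * k), sq_nonneg (7 * c - 3 * k),
      sq_nonneg (7 * d - 3 * k), sq_nonneg (7 * e - 3 * k), sq_nonneg (7 * f - 3 * k),
      sq_nonneg (7 * g - 3 * k)]
  have hz : a * (a - 1) + b * (b - 1) + c * (c - 1) + d * (d - 1) + e * (e - 1) + f * (f - 1)
      + g * (g - 1) = 0 := by
    have : (k - 1) * (k - 2) = 0 := by
      obtain h | h : k = 1 ∨ k = 2 := by omega
      all_goals subst h; norm_num
    linarith
  have na := mul_pred_nonneg a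
  have nb := mul_pred_nonneg b
  have nc := mul_pred_nonneg c
  have nd := mul_pred_nonneg d
  have ne := mul_pred_nonneg e
  have nf := mul_pred_nonneg f
  have ng := mul_pred_nonneg g
  obtain ⟨a', rfl⟩ := bit_lift a (by linarith)
  obtain ⟨b', rfl⟩ := bit_lift b (by linarith)
  obtain ⟨c', rfl⟩ := bit_lift c (by linarith)
  obtain ⟨d', rfl⟩ := bit_lift d (by linarith)
  obtain ⟨e', rfl⟩ := bit_lift e (by linarith)
  obtain ⟨f', rfl⟩ := bit_lift f (by linarith)
  obtain ⟨g', rfl⟩ := bit_lift g (by linarith)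
  obtain ⟨k', hk'⟩ : ∃ k' : Fin 2, k = (k' : ℕ) + 1 := by
    obtain h | h : k = 1 ∨ k = 2 := by omega
    · exact ⟨0, by simpa using h⟩
    · exact ⟨1, by simpa using h⟩
  have key := bits k' a' b' c' d' e' f' g' (by omega)
  convert key using 1
  funext i
  fin_cases i <;> simp <;> omega

theorem Psi_eq : PsiE7 = (allPsi : Set (Fin 7 → ℤ)) := by
  ext n
  rw [mem_Psi, Finset.mem_coe]
  exact ⟨fun h => Psi_sub n h.1 h.2, allPsi_sub n⟩

theorem rep_orbit (i : Fin 5) : MulAction.orbit KE7 (rep i) = (orb (rep i) : Set (Fin 7 → ℤ)) :=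
  orbit_eq _ (rep_closed i)

theorem allPsi_closed : ∀ x ∈ allPsi, f1 x ∈ allPsi ∧ f2 x ∈ allPsi := by
  decide +kernel

theorem rep_mem_all : ∀ i, rep i ∈ allPsi := by
  decide +kernel

theorem rep_mem_orb (i : Fin 5) : rep i ∈ orb (rep i) :=
  Finset.mem_image.2 ⟨(0, 0), by simp, rfl⟩

theorem orbit_class (n : Fin 7 → ℤ) (hn : n ∈ PsiE7) :
    ∃ i, MulAction.orbit KE7 n = (orb (rep i) : Set (Fin 7 → ℤ)) := by
  rw [Psi_eq] at hn
  obtain ⟨i, _, hi⟩ := Finset.mem_biUnion.1 (Finset.mem_coe.1 hn)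
  refine ⟨i, ?_⟩
  rw [← rep_orbit]
  apply MulAction.orbit_eq_iff.2
  rw [rep_orbit]
  exact hi

theorem orb_ne (i j : Fin 5) (h : i ≠ j) :
    (orb (rep i) : Set (Fin 7 → ℤ)) ≠ (orb (rep j) : Set (Fin 7 → ℤ)) := by
  intro he
  apply rep_disj i j h
  have := Finset.mem_coe.2 (rep_mem_orb i)
  rw [he] at this
  exact this

theorem weight_one : ∀ i, i ≠ 4 → ∀ x ∈ orb (rep i), x 6 = 1 := by
  decide +kernel

theorem weight_two : allPsi.filter (fun n => n 6 = 2) = orb (rep 4) := by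
  decide +kernel

theorem Psi_two : {n ∈ PsiE7 | n 6 = 2} = (orb (rep 4) : Set (Fin 7 → ℤ)) := by
  rw [← weight_two, Psi_eq]
  ext n
  simp

theorem stmt8 :
    PsiE7.ncard = 42 ∧
    (∀ g ∈ KE7, ∀ n ∈ PsiE7, g n ∈ PsiE7) ∧
    (∃ O₁ O₂ O₃ O₄ O₅ : Set (Fin 7 → ℤ),
      O₁ ≠ O₂ ∧ O₁ ≠ O₃ ∧ O₁ ≠ O₄ ∧ O₁ ≠ O₅ ∧ O₂ ≠ O₃ ∧ O₂ ≠ O₄ ∧ O₂ ≠ O₅ ∧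
      O₃ ≠ O₄ ∧ O₃ ≠ O₅ ∧ O₄ ≠ O₅ ∧
      {S : Set (Fin 7 → ℤ) | ∃ n ∈ PsiE7, S = MulAction.orbit KE7 n} =
        {O₁, O₂, O₃, O₄, O₅} ∧
      O₁.ncard = 7 ∧ O₂.ncard = 7 ∧ O₃.ncard = 14 ∧ O₄.ncard = 7 ∧ O₅.ncard = 7) ∧
    (∀ S : Set (Fin 7 → ℤ), (∃ n ∈ PsiE7, S = MulAction.orbit KE7 n) → S.ncard = 7 →
      S ≠ {n ∈ PsiE7 | n 6 = 2} → ∀ n ∈ S, n 6 = 1) ∧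
    (∃ n ∈ PsiE7, MulAction.orbit KE7 n = {n ∈ PsiE7 | n 6 = 2}) := by

  refine ⟨?_, ?_, ?_, ?_, ?_⟩
  · rw [Psi_eq, Set.ncard_coe_finset, allPsi_card]
  · rw [Psi_eq]
    exact maps_of_closed _ allPsi_closed
  · refine ⟨orb (rep 0), orb (rep 1), orb (rep 2), orb (rep 3), orb (rep 4),
      orb_ne _ _ (by decide), orb_ne _ _ (by decide), orb_ne _ _ (by decide),
      orb_ne _ _ (by decide), orb_ne _ _ (by decide), orb_ne _ _ (by decide),
      orb_ne _ _ (by decide), orb_ne _ _ (by decide), orb_ne _ _ (by decide),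
      orb_ne _ _ (by decide), ?_, ?_, ?_, ?_, ?_, ?_⟩
    · ext S
      simp only [Set.mem_setOf_eq, Set.mem_insert_iff, Set.mem_singleton_iff]
      constructor
      · rintro ⟨n, hn, rfl⟩
        obtain ⟨i, hi⟩ := orbit_class n hn
        rw [hi]
        fin_cases i <;> simp
      · have hrep : ∀ i, rep i ∈ PsiE7 := fun i => by
          rw [Psi_eq]; exact rep_mem_all i
        rintro (rfl | rfl | rfl | rfl | rfl)
        all_goals exact ⟨_, hrep _, (rep_orbit _).symm⟩
    all_goals rw [Set.ncard_coe_finset, rep_card]; rfl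
  · rintro S ⟨n, hn, rfl⟩ _ hS
    obtain ⟨i, hi⟩ := orbit_class n hn
    rw [Psi_two, hi] at hS
    rw [hi]
    refine weight_one i ?_
    rintro rfl
    exact hS rfl
  · refine ⟨rep 4, ?_, ?_⟩
    · rw [Psi_eq]; exact rep_mem_all 4
    · rw [Psi_two, rep_orbit]
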